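/- For distinct a, b ∈ Fin 6 let L_{ab} be the line ℂ·(e_a − e_b) in ℂ⁶, where e_a is the standard basis. Then for every matching σ of Fin 6: L_{ab} ⊆ P_σ if and only if σ a = b. Consequently each subspace P_σ contains exactly three of the fifteen lines L_{ab}, and each line L_{ab} is contained in exactly three of the fifteen subspaces P_σ (the Cremona–Richmond (15₃,15₃) configuration). -/

import Mathlib

/-- A matching of `Fin 6`: a fixed-point-free involution. -/
def IsMatching (σ : Equiv.Perm (Fin 6)) : Prop :=
  (∀ x, σ (σ x) = x) ∧ ∀ x, σ x ≠ x

/-- The linear subspace `P_σ = {x : Fin 6 → ℂ | ∀ a, x a + x (σ a) = 0}` of `ℂ⁶`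
attached to a matching `σ` (one of the fifteen planes of the Segre cubic). -/
noncomputable def matchingPlane (σ : Equiv.Perm (Fin 6)) : Submodule ℂ (Fin 6 → ℂ) where
  carrier := {x | ∀ a, x a + x (σ a) = 0}
  add_mem' := by
    intro x y hx hy a
    simp only [Pi.add_apply]
    linear_combination hx a + hy a
  zero_mem' := by intro a; simp
  smul_mem' := by
    intro c x hx a
    simp only [Pi.smul_apply, smul_eq_mul]
    linear_combination c * hx a

/-- The line `L_{ab} = ℂ·(e_a − e_b)` in `ℂ⁶`. -/
noncomputable def matchLine (a b : Fin 6) : Submodule ℂ (Fin 6 → ℂ) :=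
  Submodule.span ℂ {Pi.single a 1 - Pi.single b 1}

theorem line_le_iff (σ : Equiv.Perm (Fin 6)) (hσ : IsMatching σ) (a b : Fin 6) (hab : a ≠ b) :
    matchLine a b ≤ matchingPlane σ ↔ σ a = b := by
  have key : matchLine a b ≤ matchingPlane σ ↔
      ∀ c, (Pi.single a 1 - Pi.single b 1 : Fin 6 → ℂ) c +
        (Pi.single a 1 - Pi.single b 1 : Fin 6 → ℂ) (σ c) = 0 := by
    unfold matchLine
    rw [Submodule.span_singleton_le_iff_mem]
    rfl
  rw [key]
  constructor
  · intro h
    by_contra hne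
    have h1 := h a
    have h2 := hσ.2 a
    simp [hab, hne, h2] at h1
  · intro h c
    have hb : σ b = a := by rw [← h, hσ.1]
    by_cases hca : c = a
    · subst hca
      simp [hab, h, hab.symm]
    · by_cases hcb : c = b
      · subst hcb
        simp [hab, hb, hab.symm]
      · have h1 : σ c ≠ a := fun e => hcb (σ.injective (e.trans hb.symm))
        have h2 : σ c ≠ b := fun e => hca (σ.injective (e.trans h.symm))
        simp [hca, hcb, h1, h2]

theorem card_pairs (σ : Equiv.Perm (Fin 6)) (hσ : IsMatching σ) :
    (Finset.univ.image (fun a => s(a, σ a))).card = 3 := by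
  have h := Finset.card_eq_sum_card_image (fun a => s(a, σ a)) (Finset.univ : Finset (Fin 6))
  have h2 : ∀ s ∈ Finset.univ.image (fun a => s(a, σ a)),
      (Finset.univ.filter (fun a => s(a, σ a) = s)).card = 2 := by
    intro s hs
    obtain ⟨a, -, rfl⟩ := Finset.mem_image.1 hs
    have : Finset.univ.filter (fun c => s(c, σ c) = s(a, σ a)) = {a, σ a} := by
      ext c
      have := hσ.1 a
      simp only [Finset.mem_filter, Finset.mem_univ, true_and, Finset.mem_insert,
        Finset.mem_singleton, Sym2.eq_iff]
      constructor
      · rintro (h | h)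
        · exact Or.inl h.1
        · exact Or.inr h.1
      · rintro (h | h)
        · subst h; exact Or.inl ⟨rfl, rfl⟩
        · subst h; exact Or.inr ⟨rfl, this⟩
    rw [this, Finset.card_pair (hσ.2 a).symm]
  rw [Finset.sum_congr rfl h2] at h
  simp at h
  omega

theorem card_matchings_zero_one :
    (Finset.univ.filter (fun σ : Equiv.Perm (Fin 6) =>
      ((∀ x, σ (σ x) = x) ∧ ∀ x, σ x ≠ x) ∧ σ 0 = 1)).card = 3 := by
  have h3 : ({3, 4, 5} : Finset (Fin 6)).card = 3 := by decide
  rw [← h3]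
  refine Finset.card_bij (fun σ _ => σ 2) ?_ ?_ ?_
  · intro σ hσ
    obtain ⟨-, ⟨hi, hf⟩, h0⟩ := Finset.mem_filter.1 hσ
    have h1 : σ 1 = 0 := by rw [← h0, hi]
    have n0 : σ 2 ≠ 0 := fun e => absurd (σ.injective (e.trans h1.symm)) (by decide)
    have n1 : σ 2 ≠ 1 := fun e => absurd (σ.injective (e.trans h0.symm)) (by decide)
    have n2 := hf 2
    generalize σ 2 = y at n0 n1 n2
    revert y
    decide
  · intro σ hσ τ hτ h
    obtain ⟨-, hs, s0⟩ := Finset.mem_filter.1 hσ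
    obtain ⟨-, ht, t0⟩ := Finset.mem_filter.1 hτ
    have s1 : σ 1 = 0 := by rw [← s0, hs.1]
    have t1 : τ 1 = 0 := by rw [← t0, ht.1]
    -- the two matchings agree on `0, 1, 2, σ 2`
    have h' : σ 2 = τ 2 := h
    have hd : τ (σ 2) = σ (σ 2) := by rw [hs.1, h', ht.1]
    have n0 : σ 2 ≠ 0 := fun e => absurd (σ.injective (e.trans s1.symm)) (by decide)
    have n1 : σ 2 ≠ 1 := fun e => absurd (σ.injective (e.trans s0.symm)) (by decide)
    have n2 := hs.2 2
    -- a point outside is sent outside, to a point different from itself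
    have out : ∀ ρ : Equiv.Perm (Fin 6), ((∀ x, ρ (ρ x) = x) ∧ ∀ x, ρ x ≠ x) → ρ 0 = 1 →
        ρ 2 = σ 2 → ∀ x, x ≠ 0 → x ≠ 1 → x ≠ 2 → x ≠ σ 2 →
        ρ x ≠ 0 ∧ ρ x ≠ 1 ∧ ρ x ≠ 2 ∧ ρ x ≠ σ 2 ∧ ρ x ≠ x := by
      intro ρ hr r0 r2 x x0 x1 x2 x3
      refine ⟨fun e => x1 ?_, fun e => x0 ?_, fun e => x3 ?_, fun e => x2 ?_, hr.2 x⟩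
      · rw [← hr.1 x, e, r0]
      · exact ρ.injective (e.trans r0.symm)
      · rw [← hr.1 x, e, r2]
      · exact ρ.injective (e.trans r2.symm)
    ext1 x
    by_cases x0 : x = 0
    · rw [x0, s0, t0]
    by_cases x1 : x = 1
    · rw [x1, s1, t1]
    by_cases x2 : x = 2
    · rw [x2, h']
    by_cases x3 : x = σ 2
    · rw [x3, hd]
    have a := out σ hs s0 rfl x x0 x1 x2 x3
    have b := out τ ht t0 h'.symm x x0 x1 x2 x3
    generalize σ x = u at *
    generalize τ x = v at *
    generalize σ 2 = d at *
    omega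
  · intro y hy
    have hy' : y = 3 ∨ y = 4 ∨ y = 5 := by simpa using hy
    rcases hy' with rfl | rfl | rfl
    · exact ⟨Equiv.swap 0 1 * Equiv.swap 2 3 * Equiv.swap 4 5,
        Finset.mem_filter.2 ⟨Finset.mem_univ _, by decide⟩, by decide⟩
    · exact ⟨Equiv.swap 0 1 * Equiv.swap 2 4 * Equiv.swap 3 5,
        Finset.mem_filter.2 ⟨Finset.mem_univ _, by decide⟩, by decide⟩
    · exact ⟨Equiv.swap 0 1 * Equiv.swap 2 5 * Equiv.swap 3 4,
        Finset.mem_filter.2 ⟨Finset.mem_univ _, by decide⟩, by decide⟩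

theorem exists_move : ∀ a b : Fin 6, a ≠ b →
    ∃ g : Equiv.Perm (Fin 6), g 0 = a ∧ g 1 = b := by
  intro a b hab
  refine ⟨Equiv.swap (Equiv.swap 0 a 1) b * Equiv.swap 0 a, ?_, ?_⟩
  · have h : Equiv.swap 0 a 1 ≠ a := by
      intro h
      have := (Equiv.swap (0 : Fin 6) a).injective (h.trans (Equiv.swap_apply_left 0 a).symm)
      exact absurd this (by decide)
    rw [Equiv.Perm.mul_apply, Equiv.swap_apply_left, Equiv.swap_apply_of_ne_of_ne h.symm hab]
  · rw [Equiv.Perm.mul_apply, Equiv.swap_apply_left]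

/-- `L_{ab} ⊆ P_σ` iff `σ a = b`; hence each plane `P_σ` contains exactly three of the
fifteen lines `L_{ab}`, and each line lies on exactly three of the fifteen planes:
the Cremona–Richmond `(15₃,15₃)` configuration. -/
theorem cremona_richmond_configuration :
    (∀ σ : Equiv.Perm (Fin 6), IsMatching σ → ∀ a b : Fin 6, a ≠ b →
      (matchLine a b ≤ matchingPlane σ ↔ σ a = b)) ∧
    (∀ σ : Equiv.Perm (Fin 6), IsMatching σ →
      Nat.card {s : Sym2 (Fin 6) //
        ∃ a b : Fin 6, a ≠ b ∧ s = s(a, b) ∧ matchLine a b ≤ matchingPlane σ} = 3) ∧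
    (∀ a b : Fin 6, a ≠ b →
      Nat.card {σ : Equiv.Perm (Fin 6) //
        IsMatching σ ∧ matchLine a b ≤ matchingPlane σ} = 3) := by
  refine ⟨line_le_iff, ?_, ?_⟩
  · intro σ hσ
    rw [← card_pairs σ hσ, Nat.subtype_card]
    intro s
    simp only [Finset.mem_image, Finset.mem_univ, true_and]
    constructor
    · rintro ⟨a, rfl⟩
      exact ⟨a, σ a, (hσ.2 a).symm, rfl, (line_le_iff σ hσ _ _ (hσ.2 a).symm).2 rfl⟩
    · rintro ⟨a, b, hab, rfl, h⟩
      exact ⟨a, by rw [(line_le_iff σ hσ _ _ hab).1 h]⟩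
  · intro a b hab
    obtain ⟨g, rfl, rfl⟩ := exists_move a b hab
    rw [← card_matchings_zero_one, ← Nat.subtype_card _ (fun σ => by
      rw [Finset.mem_filter])]
    symm
    refine Nat.card_congr (Equiv.subtypeEquiv (MulAut.conj g).toEquiv ?_)
    intro σ
    have e : ∀ x, (MulAut.conj g).toEquiv σ (g x) = g (σ x) := by
      intro x
      simp [MulAut.conj_apply]
    generalize (MulAut.conj g).toEquiv σ = τ at e
    have hm : IsMatching τ ↔ ((∀ x, σ (σ x) = x) ∧ ∀ x, σ x ≠ x) := by
      unfold IsMatching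
      rw [← g.forall_congr_right (q := fun x => τ (τ x) = x),
        ← g.forall_congr_right (q := fun x => τ x ≠ x)]
      simp [e]
    rw [← hm, and_iff_right (Finset.mem_univ σ)]
    refine and_congr_right fun h => ?_
    rw [line_le_iff τ h _ _ hab, e, g.injective.eq_iff]
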